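/- Let σ ⊆ ℝ² be a 2-dimensional pointed rational polyhedral cone with primitive ray generators u, v, and set Eu(σ) := 2 − RSV(σ). If {u, v} is a ℤ-basis of ℤ² (the smooth case) then Eu(σ) = 1, and otherwise Eu(σ) ≤ 0. In particular, a torus-fixed point of a normal toric surface is a smooth point if and only if its local Euler obstruction equals 1. -/

import Mathlib

open MeasureTheory

/-- The standard lattice `ℤ²` inside `ℝ²`. -/
def Lat2 : Set (Fin 2 → ℝ) := {x | ∀ j, ∃ m : ℤ, x j = (m : ℝ)}

/-- `{e₁, e₂}` is a ℤ-basis of the lattice `ℤ² ⊆ ℝ²`, i.e. the two vectors are lattice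
vectors generating `ℤ²` as a ℤ-module. -/
def IsZBasis (e₁ e₂ : Fin 2 → ℝ) : Prop :=
  e₁ ∈ Lat2 ∧ e₂ ∈ Lat2 ∧ ∀ x ∈ Lat2, ∃ a b : ℤ, x = a • e₁ + b • e₂

/-- `u` is a primitive lattice vector: its (integer) coordinates have gcd `1`. -/
def IsPrimitive (u : Fin 2 → ℝ) : Prop :=
  ∃ a b : ℤ, u 0 = (a : ℝ) ∧ u 1 = (b : ℝ) ∧ Int.gcd a b = 1

/-- The cone spanned by two vectors: `Cone(u,v) = ℝ≥0·u + ℝ≥0·v`. -/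
def coneTwo (u v : Fin 2 → ℝ) : Set (Fin 2 → ℝ) :=
  {x | ∃ a b : ℝ, 0 ≤ a ∧ 0 ≤ b ∧ x = a • u + b • v}

/-- Matsui–Takeuchi's normalized relative subdiagram volume of a plane cone `σ` at its
apex: twice the Lebesgue measure of `σ ∖ conv((σ ∖ {0}) ∩ ℤ²)`. -/
noncomputable def RSV (σ : Set (Fin 2 → ℝ)) : ℝ :=
  2 * (volume (σ \ convexHull ℝ ((σ \ {0}) ∩ Lat2))).toReal


/-- half-open standard triangle over a set of abscissas -/
def triOver (s : Set ℝ) : Set (Fin 2 → ℝ) :=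
  {x | x 0 ∈ s ∧ x 1 ∈ Set.Ico (0:ℝ) (1 - x 0)}

lemma lint_tri : ∫⁻ x in Set.Ioo (0:ℝ) 1, ENNReal.ofReal (1 - x) = ENNReal.ofReal (1/2) := by
  rw [setLIntegral_congr (Ioo_ae_eq_Ioc (μ := volume) (a := (0:ℝ)) (b := 1)), ← ofReal_integral_eq_lintegral_ofReal]
  · congr 1
    rw [← intervalIntegral.integral_of_le (by norm_num)]
    rw [intervalIntegral.integral_sub (by simp) (by simp)]
    norm_num
  · have : IntervalIntegrable (fun x : ℝ => 1 - x) volume 0 1 :=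
      (by fun_prop : Continuous (fun x : ℝ => 1 - x)).intervalIntegrable _ _
    exact (intervalIntegrable_iff_integrableOn_Ioc_of_le (by norm_num)).1 this
  · filter_upwards [ae_restrict_mem measurableSet_Ioc] with x hx
    simp only [Pi.zero_apply]; linarith [hx.2]

lemma meas_triOver (s : Set ℝ) (hs : MeasurableSet s) : MeasurableSet (triOver s) := by
  have h1 : MeasurableSet {x : Fin 2 → ℝ | x 0 ∈ s} := (measurable_pi_apply 0) hs
  have h2 : MeasurableSet {x : Fin 2 → ℝ | 0 ≤ x 1} :=
    measurableSet_le measurable_const (measurable_pi_apply 1)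
  have h3 : MeasurableSet {x : Fin 2 → ℝ | x 1 < 1 - x 0} :=
    measurableSet_lt (measurable_pi_apply 1) (by fun_prop)
  exact h1.inter (h2.inter h3)

lemma vol_triOver (s : Set ℝ) (hs : MeasurableSet s) (h : s =ᵐ[volume] Set.Ioo (0:ℝ) 1) :
    volume (triOver s) = ENNReal.ofReal (1/2) := by
  have e := (volume_preserving_finTwoArrow ℝ).symm
  have hm := meas_triOver s hs
  rw [← e.measure_preimage hm.nullMeasurableSet]
  have hm' : MeasurableSet ((MeasurableEquiv.finTwoArrow (α := ℝ)).symm ⁻¹' triOver s) :=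
    (MeasurableEquiv.measurable _) hm
  rw [Measure.volume_eq_prod, Measure.prod_apply hm', ← lint_tri,
    ← setLIntegral_congr h, ← lintegral_indicator hs]
  congr 1
  ext x
  by_cases hx : x ∈ s
  · have : (Prod.mk x ⁻¹' ((MeasurableEquiv.finTwoArrow (α := ℝ)).symm ⁻¹' triOver s))
        = Set.Ico 0 (1 - x) := by
      ext y; simp [triOver, MeasurableEquiv.finTwoArrow, hx]
    rw [this]; simp [hx]
  · have : (Prod.mk x ⁻¹' ((MeasurableEquiv.finTwoArrow (α := ℝ)).symm ⁻¹' triOver s))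
        = ∅ := by
      ext y; simp [triOver, MeasurableEquiv.finTwoArrow, hx]
    rw [this]; simp [hx]

/-- the linear map with columns `x`, `y` -/
noncomputable def colMap (x y : Fin 2 → ℝ) : (Fin 2 → ℝ) →ₗ[ℝ] (Fin 2 → ℝ) :=
  Matrix.toLin' !![x 0, y 0; x 1, y 1]

lemma colMap_apply (x y p : Fin 2 → ℝ) : colMap x y p = p 0 • x + p 1 • y := by
  ext i; fin_cases i <;> simp [colMap, Matrix.mulVec, dotProduct, Fin.sum_univ_two] <;> ring

lemma colMap_det (x y : Fin 2 → ℝ) : LinearMap.det (colMap x y) = x 0 * y 1 - x 1 * y 0 := by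
  simp [colMap, Matrix.det_fin_two]; ring

lemma vol_img (x y : Fin 2 → ℝ) (s : Set ℝ) (hs : MeasurableSet s)
    (h : s =ᵐ[volume] Set.Ioo (0:ℝ) 1) :
    volume (colMap x y '' triOver s) = ENNReal.ofReal (|x 0 * y 1 - x 1 * y 0| / 2) := by
  rw [Measure.addHaar_image_linearMap, vol_triOver s hs h, colMap_det,
    ← ENNReal.ofReal_mul (abs_nonneg _)]
  congr 1; ring

lemma prim_int (u : Fin 2 → ℝ) (hu : IsPrimitive u) (t : ℝ) (h : t • u ∈ Lat2) :
    ∃ k : ℤ, t = k := by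
  obtain ⟨a, b, ha, hb, hg⟩ := hu
  obtain ⟨m, hm⟩ := h 0
  obtain ⟨n, hn⟩ := h 1
  simp only [Pi.smul_apply, smul_eq_mul, ha, hb] at hm hn
  have hB := Int.gcd_eq_gcd_ab a b
  rw [hg] at hB
  have hB' : (1:ℝ) = a * (a.gcdA b : ℝ) + b * (a.gcdB b : ℝ) := by exact_mod_cast hB
  refine ⟨m * a.gcdA b + n * a.gcdB b, ?_⟩
  push_cast
  rw [← hm, ← hn]
  linear_combination t * hB'

lemma key (u v : Fin 2 → ℝ) (hu : IsPrimitive u) (hv : IsPrimitive v) (d : ℤ) (hd : 2 ≤ d)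
    (hD : (d:ℝ) = |u 0 * v 1 - u 1 * v 0|) (α β : ℝ) (hα : 0 ≤ α) (hβ : 0 ≤ β)
    (hp : α • u + β • v ∈ Lat2) (h0 : α • u + β • v ≠ 0) :
    1 ≤ α + (d - 1) * β := by
  have hd' : (2:ℝ) ≤ d := by exact_mod_cast hd
  have hint : ∃ i j : ℤ, α * d = i ∧ β * d = j := by
    obtain ⟨a, b, ha, hb, -⟩ := hu
    obtain ⟨c, e, hc, he, -⟩ := hv
    obtain ⟨m, hm⟩ := hp 0
    obtain ⟨n, hn⟩ := hp 1
    simp only [Pi.smul_apply, Pi.add_apply, smul_eq_mul, ha, hb, hc, he] at hm hn hD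
    rcases abs_choice ((a:ℝ) * e - b * c) with h | h
    · refine ⟨m * e - n * c, a * n - b * m, ?_, ?_⟩ <;>
      · rw [hD, h]; push_cast; rw [← hm, ← hn]; ring
    · refine ⟨-(m * e - n * c), -(a * n - b * m), ?_, ?_⟩ <;>
      · rw [hD, h]; push_cast; rw [← hm, ← hn]; ring
  obtain ⟨i, j, hi, hj⟩ := hint
  have hi0 : 0 ≤ i := by
    have : (0:ℝ) ≤ i := by rw [← hi]; positivity
    exact_mod_cast this
  have hj0 : 0 ≤ j := by
    have : (0:ℝ) ≤ j := by rw [← hj]; positivity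
    exact_mod_cast this
  have hdpos : (0:ℝ) < d := by linarith
  suffices h : d ≤ i + (d - 1) * j by
    have h' : (d:ℝ) ≤ i + (d - 1) * j := by exact_mod_cast h
    rw [← hi, ← hj] at h'
    have : d * 1 ≤ d * (α + (d - 1) * β) := by nlinarith
    exact le_of_mul_le_mul_left this hdpos
  rcases (by omega : j = 0 ∨ (j = 1 ∧ i = 0) ∨ (j = 1 ∧ 1 ≤ i) ∨ 2 ≤ j) with h | h | h | h
  · have hb0 : β = 0 := by
      rw [h] at hj; simp at hj; rcases hj with hj | hj
      · exact hj
      · omega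
    subst hb0
    simp only [zero_smul, add_zero] at hp h0
    obtain ⟨k, hk⟩ := prim_int u hu α hp
    have hk1 : 1 ≤ k := by
      have h1 : α ≠ 0 := by rintro rfl; simp at h0
      have h2 : (0:ℝ) < k := by rw [← hk]; exact lt_of_le_of_ne hα h1.symm
      have : 0 < k := by exact_mod_cast h2
      omega
    have : k * d = i := by rw [hk] at hi; exact_mod_cast hi
    subst h; nlinarith
  · exfalso
    obtain ⟨h, h'⟩ := h
    have ha0 : α = 0 := by
      rw [h'] at hi; simp at hi; rcases hi with hi | hi
      · exact hi
      · omega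
    subst ha0
    simp only [zero_smul, zero_add] at hp
    obtain ⟨k, hk⟩ := prim_int v hv β hp
    have : k * d = 1 := by rw [hk, h] at hj; exact_mod_cast hj
    have := Int.eq_one_or_neg_one_of_mul_eq_one' this
    omega
  · rw [h.1]; linarith [h.2]
  · nlinarith

lemma hull_sub (u v : Fin 2 → ℝ) (D : u 0 * v 1 - u 1 * v 0 ≠ 0) (r s : ℝ)
    (H : ∀ α β : ℝ, 0 ≤ α → 0 ≤ β → α • u + β • v ∈ Lat2 → α • u + β • v ≠ 0 →
      1 ≤ r * α + s * β) (α β : ℝ)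
    (h : α • u + β • v ∈ convexHull ℝ ((coneTwo u v \ {0}) ∩ Lat2)) :
    1 ≤ r * α + s * β := by
  set E := u 0 * v 1 - u 1 * v 0 with hE
  let f : (Fin 2 → ℝ) →ₗ[ℝ] ℝ :=
    ((r * v 1 - s * u 1) / E) • LinearMap.proj 0 + ((s * u 0 - r * v 0) / E) • LinearMap.proj 1
  have hf : ∀ α β : ℝ, f (α • u + β • v) = r * α + s * β := by
    intro α β
    simp only [f, LinearMap.add_apply, LinearMap.smul_apply, LinearMap.proj_apply, Pi.add_apply,
      Pi.smul_apply, smul_eq_mul]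
    field_simp
    rw [hE]; ring
  have hc : Convex ℝ {x | 1 ≤ f x} := convex_halfSpace_ge f.isLinear 1
  have := convexHull_min (s := (coneTwo u v \ {0}) ∩ Lat2) ?_ hc h
  · simpa [hf] using this
  · rintro x ⟨⟨⟨a, b, ha, hb, rfl⟩, h0⟩, hL⟩
    simp only [Set.mem_ofPred_eq, hf]
    exact H a b ha hb hL h0

lemma prim_nsmul_mem (u : Fin 2 → ℝ) (hu : IsPrimitive u) (n : ℕ) (hn : 1 ≤ n) :
    (n:ℝ) • u ∈ Lat2 ∧ (n:ℝ) • u ≠ 0 := by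
  obtain ⟨a, b, ha, hb, hg⟩ := hu
  constructor
  · intro j
    fin_cases j
    · exact ⟨n * a, by simp [ha]⟩
    · exact ⟨n * b, by simp [hb]⟩
  · intro h
    have h0 := congrFun h 0
    have h1 := congrFun h 1
    have : (n:ℝ) ≠ 0 := by positivity
    simp [ha, hb, this] at h0 h1
    have : n ≠ 0 := by omega
    simp_all

lemma upper (u v : Fin 2 → ℝ) (hu : IsPrimitive u) (hv : IsPrimitive v) :
    coneTwo u v \ convexHull ℝ ((coneTwo u v \ {0}) ∩ Lat2) ⊆
      colMap u v '' triOver (Set.Ico 0 1) := by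
  rintro x ⟨⟨a, b, ha, hb, rfl⟩, hx⟩
  by_cases hab : a + b < 1
  · refine ⟨![a, b], ⟨⟨by simpa, ?_⟩, ⟨by simpa, ?_⟩⟩, ?_⟩
    · simp; linarith
    · simp; linarith
    · rw [colMap_apply]; simp
  · exfalso; apply hx
    push Not at hab
    set C := convexHull ℝ ((coneTwo u v \ {0}) ∩ Lat2) with hC
    have hconv : Convex ℝ C := convex_convexHull ℝ _
    obtain ⟨N, hN⟩ := exists_nat_ge (a + b)
    have hN1 : 1 ≤ N := by
      have : (1:ℝ) ≤ N := by linarith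
      exact_mod_cast this
    have hmu : ∀ n : ℕ, 1 ≤ n → (n:ℝ) • u ∈ C := fun n hn =>
      subset_convexHull ℝ _ ⟨⟨⟨n, 0, by positivity, le_rfl, by simp⟩, (prim_nsmul_mem u hu n hn).2⟩,
        (prim_nsmul_mem u hu n hn).1⟩
    have hmv : ∀ n : ℕ, 1 ≤ n → (n:ℝ) • v ∈ C := fun n hn =>
      subset_convexHull ℝ _ ⟨⟨⟨0, n, le_rfl, by positivity, by simp⟩, (prim_nsmul_mem v hv n hn).2⟩,
        (prim_nsmul_mem v hv n hn).1⟩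
    have aux : ∀ w : Fin 2 → ℝ, (∀ n : ℕ, 1 ≤ n → (n:ℝ) • w ∈ C) → (a + b) • w ∈ C := by
      intro w hw
      have hc2 : Convex ℝ ((LinearMap.toSpanSingleton ℝ (Fin 2 → ℝ) w) ⁻¹' C) :=
        hconv.linear_preimage _
      have h1 : (1:ℝ) ∈ (LinearMap.toSpanSingleton ℝ (Fin 2 → ℝ) w) ⁻¹' C := by
        simpa using hw 1 le_rfl
      have h2 : (N:ℝ) ∈ (LinearMap.toSpanSingleton ℝ (Fin 2 → ℝ) w) ⁻¹' C := by
        simpa using hw N hN1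
      have := hc2.ordConnected.out h1 h2 ⟨hab, hN⟩
      simpa using this
    have hs : 0 < a + b := by linarith
    have := hconv (aux u hmu) (aux v hmv) (a := a / (a+b)) (b := b / (a+b))
      (by positivity) (by positivity) (by field_simp)
    convert this using 1
    rw [smul_smul, smul_smul, div_mul_cancel₀ _ hs.ne', div_mul_cancel₀ _ hs.ne']

lemma uniq (u v : Fin 2 → ℝ) (D : u 0 * v 1 - u 1 * v 0 ≠ 0) (a b a' b' : ℝ)
    (h : a • u + b • v = a' • u + b' • v) : a = a' ∧ b = b' := by
  have h0 := congrFun h 0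
  have h1 := congrFun h 1
  simp only [Pi.smul_apply, Pi.add_apply, smul_eq_mul] at h0 h1
  constructor
  · apply mul_right_cancel₀ D; linear_combination v 1 * h0 - v 0 * h1
  · apply mul_right_cancel₀ D; linear_combination u 0 * h1 - u 1 * h0

lemma basis_of_det (u v : Fin 2 → ℝ) (hu : IsPrimitive u) (hv : IsPrimitive v)
    (D : |u 0 * v 1 - u 1 * v 0| = 1) : IsZBasis u v := by
  refine ⟨by simpa using (prim_nsmul_mem u hu 1 le_rfl).1, by simpa using (prim_nsmul_mem v hv 1 le_rfl).1, ?_⟩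
  intro x hx
  obtain ⟨a, b, ha, hb, -⟩ := hu
  obtain ⟨c, e, hc, he, -⟩ := hv
  obtain ⟨m, hm⟩ := hx 0
  obtain ⟨n, hn⟩ := hx 1
  rw [ha, hb, hc, he] at D
  rcases (abs_eq zero_le_one).1 D with h | h
  · refine ⟨m * e - n * c, a * n - b * m, ?_⟩
    ext i; fin_cases i
    · simp [ha, hc, hm]; linear_combination (-(m:ℝ)) * h
    · simp [hb, he, hn]; linear_combination (-(n:ℝ)) * h
  · refine ⟨-(m * e - n * c), -(a * n - b * m), ?_⟩
    ext i; fin_cases i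
    · simp [ha, hc, hm]; linear_combination ((m:ℝ)) * h
    · simp [hb, he, hn]; linear_combination ((n:ℝ)) * h

lemma det_of_basis (u v : Fin 2 → ℝ) (h : IsZBasis u v) :
    |u 0 * v 1 - u 1 * v 0| = 1 := by
  obtain ⟨hu, hv, H⟩ := h
  obtain ⟨a, ha⟩ := hu 0
  obtain ⟨b, hb⟩ := hu 1
  obtain ⟨c, hc⟩ := hv 0
  obtain ⟨e, he⟩ := hv 1
  obtain ⟨p, q, h1⟩ := H ![1, 0] (by intro j; fin_cases j; exacts [⟨1, by simp⟩, ⟨0, by simp⟩])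
  obtain ⟨r, s, h2⟩ := H ![0, 1] (by intro j; fin_cases j; exacts [⟨0, by simp⟩, ⟨1, by simp⟩])
  have e1 := congrFun h1 0
  have e2 := congrFun h1 1
  have e3 := congrFun h2 0
  have e4 := congrFun h2 1
  simp [ha, hb, hc, he] at e1 e2 e3 e4
  norm_cast at e1 e2 e3 e4
  have : (a * e - b * c) * (p * s - q * r) = 1 := by
    calc _ = (p * a + q * c) * (r * b + s * e) - (p * b + q * e) * (r * a + s * c) := by ring
      _ = 1 := by rw [← e1, ← e2, ← e3, ← e4]; norm_num
  rw [ha, hb, hc, he]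
  rcases Int.eq_one_or_neg_one_of_mul_eq_one this with h | h
  · have : (a:ℝ) * e - b * c = 1 := by exact_mod_cast h
    rw [this]; simp
  · have : (a:ℝ) * e - b * c = -1 := by exact_mod_cast h
    rw [this]; simp

theorem euler_obstruction_one_iff_smooth (u v : Fin 2 → ℝ)
    (hu : IsPrimitive u) (hv : IsPrimitive v)
    (hind : LinearIndependent ℝ ![u, v]) :
    (IsZBasis u v → 2 - RSV (coneTwo u v) = 1) ∧
      (¬ IsZBasis u v → 2 - RSV (coneTwo u v) ≤ 0) := by
  have D : u 0 * v 1 - u 1 * v 0 ≠ 0 := by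
    intro h
    rw [LinearIndependent.pair_iff] at hind
    have h1 := hind (v 0) (-u 0) (by
      ext i; fin_cases i
      · simp; ring
      · simp; linear_combination -h)
    have h2 := hind (v 1) (-u 1) (by
      ext i; fin_cases i
      · simp; linear_combination h
      · simp; ring)
    have := (prim_nsmul_mem v hv 1 le_rfl).2
    apply this
    ext i; fin_cases i
    · simp [h1.1]
    · simp [h2.1]
  have hIco : Set.Ico (0:ℝ) 1 =ᵐ[volume] Set.Ioo (0:ℝ) 1 := Ioo_ae_eq_Ico.symm
  constructor
  · intro hB
    have hd := det_of_basis u v hB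
    have : coneTwo u v \ convexHull ℝ ((coneTwo u v \ {0}) ∩ Lat2) =
      colMap u v '' triOver (Set.Ico 0 1) := by
      apply (upper u v hu hv).antisymm
      rintro _ ⟨x, ⟨⟨h1, h2⟩, ⟨h3, h4⟩⟩, rfl⟩
      rw [colMap_apply]
      refine ⟨⟨_, _, h1, h3, rfl⟩, fun hx => ?_⟩
      have := hull_sub u v D 1 1 ?_ _ _ hx
      · linarith
      · intro α β hα hβ hL h0
        obtain ⟨a, b, hab⟩ := hB.2.2 _ hL
        obtain ⟨r1, r2⟩ := uniq u v D α β a b (by rw [hab, Int.cast_smul_eq_zsmul, Int.cast_smul_eq_zsmul])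
        have : ¬ (α = 0 ∧ β = 0) := by rintro ⟨rfl, rfl⟩; simp at h0
        subst r1 r2
        norm_cast at *
        omega
    rw [RSV, this, vol_img u v _ measurableSet_Ico hIco, hd]
    norm_num
  · intro hB
    have hdint : ∃ d : ℤ, (d:ℝ) = |u 0 * v 1 - u 1 * v 0| := by
      obtain ⟨a, b, ha, hb, -⟩ := hu
      obtain ⟨c, e, hc, he, -⟩ := hv
      exact ⟨|a * e - b * c|, by rw [ha, hb, hc, he]; push_cast; rfl⟩
    obtain ⟨d, hd⟩ := hdint
    have hd2 : 2 ≤ d := by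
      have h1 : d ≠ 1 := by
        rintro rfl; exact hB (basis_of_det u v hu hv (by rw [← hd]; simp))
      have h2 : (0:ℝ) < d := by rw [hd]; positivity
      have h3 : 0 < d := by exact_mod_cast h2
      omega
    have hd2' : (2:ℝ) ≤ d := by exact_mod_cast hd2
    have hdpos : (0:ℝ) < d := by linarith
    set S := coneTwo u v \ convexHull ℝ ((coneTwo u v \ {0}) ∩ Lat2) with hS
    have hfin : volume S ≠ ⊤ := by
      apply ne_top_of_le_ne_top _ (measure_mono (upper u v hu hv))
      rw [vol_img u v _ measurableSet_Ico hIco]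
      exact ENNReal.ofReal_ne_top
    set w : Fin 2 → ℝ := (1 / (d:ℝ)) • u + (1 / (d:ℝ)) • v with hw
    have rep1 : ∀ x : Fin 2 → ℝ, colMap u w x = (x 0 + x 1 / d) • u + (x 1 / d) • v := by
      intro x; rw [colMap_apply, hw]; ext i; simp; ring
    have rep2 : ∀ x : Fin 2 → ℝ, colMap v w x = (x 1 / d) • u + (x 0 + x 1 / d) • v := by
      intro x; rw [colMap_apply, hw]; ext i; simp; ring
    have T1 : colMap u w '' triOver (Set.Ioo 0 1) ⊆ S := by
      rintro _ ⟨x, ⟨⟨h1, h2⟩, ⟨h3, h4⟩⟩, rfl⟩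
      rw [rep1]
      refine ⟨⟨_, _, by positivity, by positivity, rfl⟩, fun hx => ?_⟩
      have := hull_sub u v D 1 (d - 1) (fun α β hα hβ hL h0 => by
        rw [one_mul]; exact key u v hu hv d hd2 hd α β hα hβ hL h0) _ _ hx
      have e : 1 * (x 0 + x 1 / d) + (d - 1) * (x 1 / d) = x 0 + x 1 := by field_simp; ring
      linarith
    have T2 : colMap v w '' triOver (Set.Ioo 0 1) ⊆ S := by
      rintro _ ⟨x, ⟨⟨h1, h2⟩, ⟨h3, h4⟩⟩, rfl⟩
      rw [rep2]
      refine ⟨⟨_, _, by positivity, by positivity, rfl⟩, fun hx => ?_⟩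
      have := hull_sub u v D (d - 1) 1 (fun α β hα hβ hL h0 => by
        have := key v u hv hu d hd2 (by rw [hd, abs_sub_comm]; ring_nf) β α hβ hα
          (by rwa [add_comm]) (by rwa [add_comm])
        linarith) _ _ hx
      have e : (d - 1) * (x 1 / d) + 1 * (x 0 + x 1 / d) = x 0 + x 1 := by field_simp; ring
      linarith
    have hdisj : Disjoint (colMap u w '' triOver (Set.Ioo 0 1))
        (colMap v w '' triOver (Set.Ioo 0 1)) := by
      rw [Set.disjoint_left]
      rintro _ ⟨x, ⟨⟨h1, h2⟩, ⟨h3, h4⟩⟩, rfl⟩ ⟨y, ⟨⟨k1, k2⟩, ⟨k3, k4⟩⟩, hy⟩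
      rw [rep1, rep2] at hy
      obtain ⟨q1, q2⟩ := uniq u v D _ _ _ _ hy
      linarith
    have dw1 : |u 0 * w 1 - u 1 * w 0| = 1 := by
      have : u 0 * w 1 - u 1 * w 0 = (u 0 * v 1 - u 1 * v 0) / d := by simp [hw]; ring
      rw [this, abs_div, ← hd, abs_of_pos hdpos, div_self hdpos.ne']
    have dw2 : |v 0 * w 1 - v 1 * w 0| = 1 := by
      have : v 0 * w 1 - v 1 * w 0 = -((u 0 * v 1 - u 1 * v 0) / d) := by simp [hw]; ring
      rw [this, abs_neg, abs_div, ← hd, abs_of_pos hdpos, div_self hdpos.ne']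
    have hinj : Function.Injective (colMap v w) := by
      have : LinearMap.det (colMap v w) ≠ 0 := by
        rw [colMap_det]; intro h; rw [h] at dw2; simp at dw2
      exact (LinearMap.equivOfDetNeZero (colMap v w) this).injective
    have hm2 : MeasurableSet (colMap v w '' triOver (Set.Ioo 0 1)) := by
      refine (meas_triOver _ measurableSet_Ioo).image_of_continuousOn_injOn
        (LinearMap.continuous_of_finiteDimensional _).continuousOn hinj.injOn
    have hle : ENNReal.ofReal 1 ≤ volume S := by
      calc ENNReal.ofReal 1 = volume (colMap u w '' triOver (Set.Ioo 0 1)) +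
            volume (colMap v w '' triOver (Set.Ioo 0 1)) := by
            rw [vol_img _ _ _ measurableSet_Ioo (Filter.EventuallyEq.refl _ _),
              vol_img _ _ _ measurableSet_Ioo (Filter.EventuallyEq.refl _ _), dw1, dw2,
              ← ENNReal.ofReal_add (by norm_num) (by norm_num)]
            norm_num
        _ = volume (colMap u w '' triOver (Set.Ioo 0 1) ∪ colMap v w '' triOver (Set.Ioo 0 1)) :=
            (measure_union hdisj hm2).symm
        _ ≤ volume S := measure_mono (Set.union_subset T1 T2)
    have := (ENNReal.ofReal_le_iff_le_toReal hfin).1 hle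
    rw [RSV]
    linarith
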